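/- Let A be a finite set of k relatively prime positive integers (i.e., gcd of the elements of A equals 1), and let p_A(n) denote the number of partitions of n with parts in A. Then p_A(n) = (1/∏_{a∈A} a) · n^{k-1}/(k-1)! + O(n^{k-2}) as n → ∞. -/

import Mathlib

open Filter Asymptotics

/-- The number of partitions of `n` with all parts in the finite set `A`. -/
def partitionsIn (A : Finset ℕ) (n : ℕ) : ℕ :=
  (Finset.univ.filter fun p : Nat.Partition n => ∀ i ∈ p.parts, i ∈ A).card

/-- Partitions with parts in `insert b A`, split by whether `b` occurs as a part. -/
lemma partitionsIn_insert {A : Finset ℕ} {b : ℕ} (hb : 0 < b) (hbA : b ∉ A) (n : ℕ) :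
    partitionsIn (insert b A) n =
      partitionsIn A n + if b ≤ n then partitionsIn (insert b A) (n - b) else 0 := by
  unfold partitionsIn
  rw [← Finset.card_filter_add_card_filter_not (fun p : Nat.Partition n => b ∉ p.parts)]
  congr 1
  · congr 1
    ext p
    simp only [Finset.mem_filter, Finset.mem_univ, true_and, Finset.mem_insert]
    constructor
    · rintro ⟨h, hp⟩ i hi
      rcases h i hi with rfl | h
      · exact absurd hi hp
      · exact h
    · exact fun h => ⟨fun i hi => Or.inr (h i hi), fun hp => hbA (h b hp)⟩
  · split_ifs with hbn
    · refine Finset.card_bij'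
        (fun p hp => ⟨p.parts.erase b, fun hi => p.parts_pos (Multiset.mem_of_mem_erase hi), ?_⟩)
        (fun q _ => ⟨b ::ₘ q.parts, ?_, ?_⟩) ?_ ?_ ?_ ?_
      · have hbp : b ∈ p.parts := by simpa using (Finset.mem_filter.1 hp).2
        have h := Multiset.sum_erase hbp
        rw [p.parts_sum] at h
        omega
      · intro i hi
        rcases Multiset.mem_cons.1 hi with rfl | hi
        · exact hb
        · exact q.parts_pos hi
      · rw [Multiset.sum_cons, q.parts_sum]
        omega
      · intro p hp
        simp only [Finset.mem_filter, Finset.mem_univ, true_and] at hp ⊢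
        exact fun i hi => hp.1 i (Multiset.mem_of_mem_erase hi)
      · intro q hq
        simp only [Finset.mem_filter, Finset.mem_univ, true_and] at hq ⊢
        refine ⟨fun i hi => ?_, by simp⟩
        rcases Multiset.mem_cons.1 hi with rfl | hi
        · exact Finset.mem_insert_self _ _
        · exact hq i hi
      · intro p hp
        have hbp : b ∈ p.parts := by simpa using (Finset.mem_filter.1 hp).2
        exact Nat.Partition.ext (Multiset.cons_erase hbp)
      · intro q _
        exact Nat.Partition.ext (Multiset.erase_cons_head _ _)
    · rw [Finset.card_eq_zero, Finset.filter_eq_empty_iff]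
      intro p _ hp
      rw [not_not] at hp
      have := Multiset.le_sum_of_mem hp
      rw [p.parts_sum] at this
      exact hbn this

lemma partitionsIn_insert_eq_sum {A : Finset ℕ} {b : ℕ} (hb : 0 < b) (hbA : b ∉ A) (n : ℕ) :
    partitionsIn (insert b A) n =
      ∑ j ∈ (Finset.range (n + 1)).filter (fun j => j ≡ n [MOD b]), partitionsIn A j := by
  induction n using Nat.strong_induction_on with
  | _ n ih =>
    rw [partitionsIn_insert hb hbA]
    split_ifs with hbn
    · rw [ih (n - b) (by omega)]
      have hmod : n - b ≡ n [MOD b] := by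
        simpa [Nat.ModEq, Nat.sub_add_cancel hbn] using (Nat.add_mod_right (n - b) b).symm
      have hset : (Finset.range (n + 1)).filter (fun j => j ≡ n [MOD b]) =
          insert n ((Finset.range (n - b + 1)).filter (fun j => j ≡ n - b [MOD b])) := by
        ext j
        simp only [Finset.mem_filter, Finset.mem_range, Finset.mem_insert]
        constructor
        · rintro ⟨hj, h⟩
          by_cases hjn : j = n
          · exact Or.inl hjn
          · have := Nat.le_of_dvd (by omega) ((Nat.modEq_iff_dvd' (by omega)).1 h)
            exact Or.inr ⟨by omega, h.trans hmod.symm⟩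
        · rintro (rfl | ⟨hj, h⟩)
          · exact ⟨by omega, rfl⟩
          · exact ⟨by omega, h.trans hmod⟩
      rw [hset, Finset.sum_insert (by simp; omega)]
    · have hset : (Finset.range (n + 1)).filter (fun j => j ≡ n [MOD b]) = {n} := by
        ext j
        simp only [Finset.mem_filter, Finset.mem_range, Finset.mem_singleton]
        constructor
        · rintro ⟨hj, h⟩
          exact h.eq_of_lt_of_lt (by omega) (by omega)
        · rintro rfl
          exact ⟨by omega, rfl⟩
      rw [hset, Finset.sum_singleton, add_zero]

lemma partitionsIn_empty (n : ℕ) : partitionsIn ∅ n = if n = 0 then 1 else 0 := by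
  unfold partitionsIn
  split_ifs with h
  · subst h
    simp
  · rw [Finset.card_eq_zero, Finset.filter_eq_empty_iff]
    intro p _ hp
    apply h
    have h0 : p.parts = 0 :=
      Multiset.eq_zero_of_forall_notMem fun i hi => Finset.notMem_empty i (hp i hi)
    rw [← p.parts_sum, h0, Multiset.sum_zero]

lemma partitionsIn_singleton {a : ℕ} (ha : 0 < a) (n : ℕ) :
    partitionsIn {a} n = if a ∣ n then 1 else 0 := by
  rw [← insert_empty_eq a, partitionsIn_insert_eq_sum ha (Finset.notMem_empty a),
    Finset.sum_filter, Finset.sum_eq_single 0]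
  · simp [partitionsIn_empty, Nat.modEq_zero_iff_dvd, Nat.ModEq.comm (a := 0)]
  · intro j _ hj
    simp [partitionsIn_empty, hj]
  · simp

/-- A block of `L` consecutive naturals contains exactly one element of a residue class. -/
lemma exists_filter_Ico_modEq_eq_singleton {L : ℕ} (hL : 0 < L) (c m : ℕ) :
    ∃ j, (Finset.Ico m (m + L)).filter (fun j => j ≡ c [MOD L]) = {j} := by
  rw [← Finset.card_eq_one, Nat.filter_Ico_card_eq_of_periodic]
  · rw [Nat.count_modEq_card _ hL]
    simp [Nat.div_self hL, Nat.mod_self]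
  · intro j
    simp [Nat.ModEq]

lemma pow_succ_sub_pow_succ_bounds (e : ℕ) {x y : ℝ} (hx : 0 ≤ x) (hxy : x ≤ y) :
    (e + 1) * (y - x) * x ^ e ≤ y ^ (e + 1) - x ^ (e + 1) ∧
      y ^ (e + 1) - x ^ (e + 1) ≤ (e + 1) * (y - x) * y ^ e := by
  induction e with
  | zero => constructor <;> simp
  | succ e ih =>
    obtain ⟨h1, h2⟩ := ih
    have hy := hx.trans hxy
    have h3 : x ^ (e + 1) ≤ y ^ (e + 1) := pow_le_pow_left₀ hx hxy _
    push_cast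
    constructor
    · calc ((e : ℝ) + 1 + 1) * (y - x) * x ^ (e + 1)
          = x * ((e + 1) * (y - x) * x ^ e) + (y - x) * x ^ (e + 1) := by ring
        _ ≤ x * (y ^ (e + 1) - x ^ (e + 1)) + (y - x) * y ^ (e + 1) := by
          gcongr
        _ = _ := by ring
    · calc y ^ (e + 1 + 1) - x ^ (e + 1 + 1)
          = y * (y ^ (e + 1) - x ^ (e + 1)) + (y - x) * x ^ (e + 1) := by ring
        _ ≤ y * ((e + 1) * (y - x) * y ^ e) + (y - x) * y ^ (e + 1) := by
          gcongr
        _ = _ := by ring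

lemma abs_sum_pow_modEq_sub_le {L : ℕ} (hL : 0 < L) (c e n : ℕ) :
    |∑ j ∈ (Finset.range (n + 1)).filter (fun j => j ≡ c [MOD L]), (j : ℝ) ^ e -
      (n : ℝ) ^ (e + 1) / ((e + 1) * L)| ≤ (n : ℝ) ^ e := by
  have hL' : (0 : ℝ) < L := by exact_mod_cast hL
  have he : (0 : ℝ) < (e + 1) * L := by positivity
  induction n using Nat.strong_induction_on with
  | _ n ih =>
    by_cases hn : n < L
    · have hcard : ((Finset.range (n + 1)).filter (fun j => j ≡ c [MOD L])).card ≤ 1 := by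
        rw [Finset.card_le_one]
        intro i hi j hj
        simp only [Finset.mem_filter, Finset.mem_range] at hi hj
        exact (hi.2.trans hj.2.symm).eq_of_lt_of_lt (by omega) (by omega)
      apply abs_sub_le_of_nonneg_of_le
      · positivity
      · refine (Finset.sum_le_card_nsmul _ _ ((n : ℝ) ^ e) fun j hj => ?_).trans ?_
        · have : j ≤ n := by
            have := (Finset.mem_filter.1 hj).1
            rw [Finset.mem_range] at this
            omega
          gcongr
        · rw [nsmul_eq_mul]
          exact mul_le_of_le_one_left (by positivity) (by exact_mod_cast hcard)
      · positivity
      · rw [div_le_iff₀ he, pow_succ]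
        have : (n : ℝ) ≤ L := by exact_mod_cast hn.le
        have : (n : ℝ) ≤ (e + 1) * L := by nlinarith [(Nat.cast_nonneg e : (0 : ℝ) ≤ e)]
        gcongr
    · obtain ⟨m, rfl⟩ := Nat.exists_eq_add_of_le' (not_lt.1 hn)
      obtain ⟨i, hi⟩ := exists_filter_Ico_modEq_eq_singleton hL c (m + 1)
      have him : i ∈ Finset.Ico (m + 1) (m + 1 + L) :=
        (Finset.mem_filter.1 (hi ▸ Finset.mem_singleton_self i)).1
      rw [Finset.mem_Ico] at him
      have hsum : ∑ j ∈ (Finset.range (m + L + 1)).filter (fun j => j ≡ c [MOD L]), (j : ℝ) ^ e =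
          ∑ j ∈ (Finset.range (m + 1)).filter (fun j => j ≡ c [MOD L]), (j : ℝ) ^ e +
            (i : ℝ) ^ e := by
        rw [← Finset.sum_singleton (fun j : ℕ => (j : ℝ) ^ e) i, ← hi, Finset.sum_filter,
          Finset.sum_filter, Finset.sum_filter, add_right_comm,
          Finset.sum_range_add_sum_Ico _ (by omega)]
      have hlow : (m : ℝ) ^ e ≤ (i : ℝ) ^ e := by
        have : m ≤ i := by omega
        gcongr
      have hup : (i : ℝ) ^ e ≤ ((m : ℝ) + L) ^ e := by
        have : (i : ℝ) ≤ m + L := by exact_mod_cast (by omega : i ≤ m + L)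
        gcongr
      obtain ⟨h1, h2⟩ := pow_succ_sub_pow_succ_bounds e (Nat.cast_nonneg m : (0 : ℝ) ≤ m)
        (le_add_of_nonneg_right hL'.le)
      rw [add_sub_cancel_left, mul_comm, ← le_div_iff₀ he, sub_div] at h1
      rw [add_sub_cancel_left, mul_comm (_ * _), ← div_le_iff₀ he, sub_div] at h2
      have h := abs_le.1 (ih m (by omega))
      rw [hsum, abs_le]
      push_cast
      constructor <;> linarith [h.1, h.2]

/-- The simultaneous conditions `j ≡ n [MOD b]` and `d ∣ j` either define a residue class modulo
`lcm d b` or are contradictory, according to whether `gcd d b` divides `n`. -/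
lemma abs_sum_ite_dvd_pow_modEq_sub_le {b d : ℕ} (hb : 0 < b) (hd : 0 < d) (e n : ℕ) :
    |∑ j ∈ (Finset.range (n + 1)).filter (fun j => j ≡ n [MOD b]),
        (if d ∣ j then (j : ℝ) ^ e else 0) -
      (if d.gcd b ∣ n then (n : ℝ) ^ (e + 1) / ((e + 1) * d.lcm b) else 0)| ≤ (n : ℝ) ^ e := by
  rw [← Finset.sum_filter, Finset.filter_filter]
  split_ifs with hg
  · have hc := (Nat.chineseRemainder' (n := d) (m := b) (a := 0) (b := n)
      ((Nat.modEq_zero_iff_dvd.2 hg).symm)).2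
    set c : ℕ := (Nat.chineseRemainder' (n := d) (m := b) (a := 0) (b := n)
      ((Nat.modEq_zero_iff_dvd.2 hg).symm)).1
    have hset : (Finset.range (n + 1)).filter (fun j => j ≡ n [MOD b] ∧ d ∣ j) =
        (Finset.range (n + 1)).filter (fun j => j ≡ c [MOD d.lcm b]) := by
      refine Finset.filter_congr fun j _ => ?_
      rw [← Nat.modEq_zero_iff_dvd]
      exact ⟨fun h => Nat.mod_lcm (h.2.trans hc.1.symm) (h.1.trans hc.2.symm),
        fun h => ⟨(h.of_dvd (Nat.dvd_lcm_right d b)).trans hc.2,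
          (h.of_dvd (Nat.dvd_lcm_left d b)).trans hc.1⟩⟩
    rw [hset]
    exact abs_sum_pow_modEq_sub_le (Nat.lcm_pos hd hb) c e n
  · rw [Finset.filter_false_of_mem, Finset.sum_empty, sub_zero, abs_zero]
    · positivity
    · rintro j _ ⟨h, hdj⟩
      exact hg ((h.dvd_iff (Nat.gcd_dvd_right d b)).1 ((Nat.gcd_dvd_left d b).trans hdj))

/-- The asymptotic formula for arbitrary `gcd`. The factor `e` in the error term makes the formula
exact for a single part. -/
lemma exists_abs_partitionsIn_sub_le (A : Finset ℕ) (hne : A.Nonempty) (hpos : ∀ a ∈ A, 0 < a) :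
    ∀ e : ℕ, A.card = e + 1 → ∃ C : ℝ, 0 ≤ C ∧ ∀ n : ℕ,
      |(partitionsIn A n : ℝ) - (A.gcd id : ℕ) / ((e.factorial : ℝ) * ∏ a ∈ A, (a : ℝ)) *
        (if A.gcd id ∣ n then (n : ℝ) ^ e else 0)| ≤ C * e * ((n : ℝ) + 1) ^ (e - 1) := by
  induction hne using Finset.Nonempty.cons_induction with
  | singleton a =>
    intro e he
    obtain rfl : e = 0 := by simpa using he.symm
    have ha : 0 < a := hpos a (by simp)
    have ha' : (a : ℝ) ≠ 0 := by exact_mod_cast ha.ne'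
    refine ⟨0, le_rfl, fun n => ?_⟩
    rw [partitionsIn_singleton ha]
    simp [ha']
  | cons b A hbA hA ih =>
    rw [Finset.cons_eq_insert] at *
    intro e he
    rw [Finset.card_insert_of_notMem hbA] at he
    have hb : 0 < b := hpos b (Finset.mem_insert_self b A)
    have hApos : ∀ a ∈ A, 0 < a := fun a ha => hpos a (Finset.mem_insert_of_mem ha)
    obtain ⟨e, rfl⟩ : ∃ f, e = f + 1 := ⟨e - 1, by have := hA.card_pos; omega⟩
    obtain ⟨C, hC, hbound⟩ := ih hApos e (by omega)
    rw [Finset.gcd_insert, Finset.prod_insert hbA]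
    have hd : 0 < A.gcd id := by
      obtain ⟨a, ha⟩ := hA
      exact Nat.pos_of_dvd_of_pos (Finset.gcd_dvd ha) (hApos a ha)
    have hP : (0 : ℝ) < ∏ a ∈ A, (a : ℝ) :=
      Finset.prod_pos fun a ha => by exact_mod_cast hApos a ha
    set d := A.gcd id
    set P : ℝ := ∏ a ∈ A, (a : ℝ)
    set K : ℝ := d / ((e.factorial : ℝ) * P) with hK
    have hK0 : 0 ≤ K := by positivity
    refine ⟨C * e + K, by positivity, fun n => ?_⟩
    set S := (Finset.range (n + 1)).filter (fun j => j ≡ n [MOD b]) with hS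
    have hgl : ((d.gcd b : ℕ) : ℝ) * (d.lcm b : ℕ) = d * b := by
      exact_mod_cast Nat.gcd_mul_lcm d b
    have hmain : ((gcd (id b) d : ℕ) : ℝ) / (((e + 1).factorial : ℝ) * (b * P)) *
        (if gcd (id b) d ∣ n then (n : ℝ) ^ (e + 1) else 0) =
        K * (if d.gcd b ∣ n then (n : ℝ) ^ (e + 1) / ((e + 1) * d.lcm b) else 0) := by
      have hg : gcd (id b) d = d.gcd b := Nat.gcd_comm b d
      rw [hg]
      split_ifs
      · rw [hK, Nat.factorial_succ]
        push_cast
        have : (e.factorial : ℝ) ≠ 0 := by positivity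
        field_simp
        linear_combination (n : ℝ) ^ (e + 1) * hgl
      · simp
    have herr : |∑ j ∈ S, ((partitionsIn A j : ℝ) - K * (if d ∣ j then (j : ℝ) ^ e else 0))| ≤
        C * e * ((n : ℝ) + 1) ^ e := by
      refine (Finset.abs_sum_le_sum_abs _ _).trans ?_
      refine (Finset.sum_le_card_nsmul S _ (C * e * ((n : ℝ) + 1) ^ (e - 1)) fun j hj => ?_).trans ?_
      · have : j ≤ n := by
          have := (Finset.mem_filter.1 hj).1
          rw [Finset.mem_range] at this
          omega
        refine (hbound j).trans ?_
        gcongr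
      · have hcard : (S.card : ℝ) ≤ n + 1 := by
          exact_mod_cast (Finset.card_filter_le _ _).trans (Finset.card_range (n + 1)).le
        rw [nsmul_eq_mul]
        rcases Nat.eq_zero_or_pos e with rfl | he0
        · simp
        · calc (S.card : ℝ) * (C * e * ((n : ℝ) + 1) ^ (e - 1))
              ≤ (n + 1) * (C * e * ((n : ℝ) + 1) ^ (e - 1)) := by gcongr
            _ = C * e * ((n : ℝ) + 1) ^ (e - 1 + 1) := by ring
            _ = _ := by rw [Nat.sub_add_cancel he0]
    have hpow := abs_sum_ite_dvd_pow_modEq_sub_le hb hd e n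
    rw [hmain, partitionsIn_insert_eq_sum hb hbA, Nat.cast_sum, ← hS, Nat.add_sub_cancel]
    rw [Finset.sum_sub_distrib, ← Finset.mul_sum] at herr
    rw [← hS] at hpow
    set T := ∑ j ∈ S, (if d ∣ j then (j : ℝ) ^ e else 0)
    set M : ℝ := if d.gcd b ∣ n then (n : ℝ) ^ (e + 1) / ((e + 1) * d.lcm b) else 0
    have hn1 : (n : ℝ) ^ e ≤ ((n : ℝ) + 1) ^ e := by
      gcongr
      linarith
    calc |∑ j ∈ S, (partitionsIn A j : ℝ) - K * M|
        = |(∑ j ∈ S, (partitionsIn A j : ℝ) - K * T) + K * (T - M)| := by ring_nf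
      _ ≤ |∑ j ∈ S, (partitionsIn A j : ℝ) - K * T| + |K * (T - M)| := abs_add_le _ _
      _ ≤ C * e * ((n : ℝ) + 1) ^ e + K * ((n : ℝ) + 1) ^ e := by
        rw [abs_mul, abs_of_nonneg hK0]
        gcongr
        exact hpow.trans hn1
      _ = (C * e + K) * 1 * ((n : ℝ) + 1) ^ e := by ring
      _ ≤ (C * e + K) * ((e + 1 : ℕ) : ℝ) * ((n : ℝ) + 1) ^ e := by
        gcongr
        exact_mod_cast Nat.le_add_left 1 e

/-- Let `A` be a finite set of `k` relatively prime positive integers. Then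
`p_A(n) = (1/∏_{a ∈ A} a) · n^(k-1)/(k-1)! + O(n^(k-2))` as `n → ∞`. -/
theorem partitionsIn_asymptotic (A : Finset ℕ) (hpos : ∀ a ∈ A, 0 < a)
    (hgcd : A.gcd id = 1) :
    (fun n : ℕ => (partitionsIn A n : ℝ) -
        (1 / ∏ a ∈ A, (a : ℝ)) * (n : ℝ) ^ (A.card - 1) / (Nat.factorial (A.card - 1)))
      =O[atTop] fun n : ℕ => (n : ℝ) ^ (A.card - 2) := by
  have hne : A.Nonempty := by
    rw [Finset.nonempty_iff_ne_empty]
    rintro rfl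
    simp at hgcd
  obtain ⟨e, he⟩ : ∃ e, A.card = e + 1 := ⟨A.card - 1, by have := hne.card_pos; omega⟩
  obtain ⟨C, hC, h⟩ := exists_abs_partitionsIn_sub_le A hne hpos e he
  rw [he, Nat.add_sub_cancel, show e + 1 - 2 = e - 1 by omega]
  refine IsBigO.of_bound (C * e * 2 ^ (e - 1)) ?_
  filter_upwards [eventually_ge_atTop 1] with n hn
  have hn' : (1 : ℝ) ≤ n := by exact_mod_cast hn
  have hform : (1 / ∏ a ∈ A, (a : ℝ)) * (n : ℝ) ^ e / (e.factorial : ℝ) =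
      (A.gcd id : ℕ) / ((e.factorial : ℝ) * ∏ a ∈ A, (a : ℝ)) *
        (if A.gcd id ∣ n then (n : ℝ) ^ e else 0) := by
    rw [hgcd, if_pos (one_dvd n), Nat.cast_one, div_mul_eq_mul_div, div_mul_eq_mul_div, div_div,
      mul_comm (∏ a ∈ A, (a : ℝ))]
  rw [hform, Real.norm_eq_abs, Real.norm_of_nonneg (by positivity), mul_assoc, ← mul_pow]
  refine (h n).trans ?_
  gcongr
  linarith
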